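/- arXiv:1110.3723 — 4 statements merged into one kernel-verified Lean document; each statement's English description precedes it below -/
import Mathlib

section
/- Let N ≥ 1 be a natural number, τ, γ > 0, and let p_0, …, p_N : ℝ → ℝ satisfy the Kolmogorov equations ṗ_k = a_{k−1} p_{k−1} − (a_k + c_k) p_k + c_{k+1} p_{k+1} with a_k = τ k (N − k), c_k = γ k, a_{−1} = c_{N+1} = 0. Then the density-dependent moments y_j(t) = Σ_{k=0}^N (k/N)^j p_k(t) satisfy the system ẏ_1 = (β − γ) y_1 − β y_2 and ẏ_2 = 2(β − γ) y_2 − 2β y_3 + (1/N)((β + γ) y_1 − β y_2), where β = τ N. -/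
open Finset

theorem sbp_aux (f A C : ℤ → ℝ) (M : ℕ) :
    ∑ k ∈ range (M + 1), f k * (A ((k:ℤ) - 1) - (A k + C k) + C ((k:ℤ) + 1))
    = ∑ k ∈ range (M + 1), ((f ((k:ℤ) + 1) - f k) * A k + (f ((k:ℤ) - 1) - f k) * C k)
      + f 0 * A (-1) - f (M + 1) * A M + f M * C (M + 1) - f (-1) * C 0 := by
  induction M with
  | zero => simp; ring
  | succ n ih =>
    rw [sum_range_succ, ih, sum_range_succ _ (n + 1)]
    push_cast
    rw [show (n:ℤ) + 1 - 1 = n by ring]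
    ring

theorem moment_aux
    (N : ℕ) (τ γ : ℝ)
    (p : ℤ → ℝ → ℝ) (a c : ℤ → ℝ)
    (ha : ∀ k : ℤ, a k = if 0 ≤ k ∧ k ≤ (N : ℤ) then τ * k * ((N : ℝ) - k) else 0)
    (hc : ∀ k : ℤ, c k = if 0 ≤ k ∧ k ≤ (N : ℤ) then γ * k else 0)
    (hKE : ∀ k : ℤ, 0 ≤ k → k ≤ (N : ℤ) → ∀ t : ℝ,
      HasDerivAt (p k)
        (a (k - 1) * p (k - 1) t - (a k + c k) * p k t + c (k + 1) * p (k + 1) t) t)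
    (f : ℤ → ℝ) (t : ℝ) :
    HasDerivAt (fun t => ∑ k ∈ range (N + 1), f k * p (k : ℤ) t)
      (∑ k ∈ range (N + 1), ((f ((k:ℤ) + 1) - f k) * (τ * k * ((N : ℝ) - k))
        + (f ((k:ℤ) - 1) - f k) * (γ * k)) * p k t) t := by
  have h : HasDerivAt (fun t => ∑ k ∈ range (N + 1), f k * p (k : ℤ) t)
      (∑ k ∈ range (N + 1), f k * (a ((k:ℤ) - 1) * p ((k:ℤ) - 1) t
        - (a k + c k) * p k t + c ((k:ℤ) + 1) * p ((k:ℤ) + 1) t)) t := by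
    apply HasDerivAt.fun_sum
    intro k hk
    have hk' := mem_range.1 hk
    exact (hKE k (by omega) (by omega) t).const_mul _
  convert h using 1
  have h2 := sbp_aux f (fun k => a k * p k t) (fun k => c k * p k t) N
  have e1 : a (-1) = 0 := by rw [ha]; simp
  have e2 : a N = 0 := by rw [ha]; simp
  have e3 : c 0 = 0 := by rw [hc]; simp
  have e4 : c (N + 1) = 0 := by rw [hc]; simp
  simp only [e1, e2, e3, e4, zero_mul, mul_zero, add_zero, sub_zero] at h2
  simp only [add_mul (a _) (c _)]
  rw [h2]
  apply sum_congr rfl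
  intro k hk
  have hk' := mem_range.1 hk
  have ea : a k = τ * k * ((N : ℝ) - k) := by
    rw [ha, if_pos ⟨by omega, by omega⟩]; simp
  have ec : c k = γ * k := by
    rw [hc, if_pos ⟨by omega, by omega⟩]; simp
  rw [ea, ec]; ring

/-- For the SIS epidemic on the complete graph with `N` nodes, with Kolmogorov
equations `ṗ_k = a_{k-1} p_{k-1} - (a_k + c_k) p_k + c_{k+1} p_{k+1}`,
`a_k = τ k (N - k)`, `c_k = γ k` (for `0 ≤ k ≤ N`, and `a_{-1} = c_{N+1} = 0`),
the density-dependent moments `y_j = Σ (k/N)^j p_k` satisfy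
`ẏ₁ = (β - γ) y₁ - β y₂` and
`ẏ₂ = 2(β - γ) y₂ - 2β y₃ + (1/N)((β + γ) y₁ - β y₂)` with `β = τ N`. -/
theorem density_moment_system
    (N : ℕ) (hN : 1 ≤ N) (τ γ : ℝ) (hτ : 0 < τ) (hγ : 0 < γ)
    (p : ℤ → ℝ → ℝ) (a c : ℤ → ℝ)
    (ha : ∀ k : ℤ, a k = if 0 ≤ k ∧ k ≤ (N : ℤ) then τ * k * ((N : ℝ) - k) else 0)
    (hc : ∀ k : ℤ, c k = if 0 ≤ k ∧ k ≤ (N : ℤ) then γ * k else 0)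
    (hKE : ∀ k : ℤ, 0 ≤ k → k ≤ (N : ℤ) → ∀ t : ℝ,
      HasDerivAt (p k)
        (a (k - 1) * p (k - 1) t - (a k + c k) * p k t + c (k + 1) * p (k + 1) t) t)
    (β : ℝ) (hβ : β = τ * N)
    (y₁ y₂ y₃ : ℝ → ℝ)
    (hy₁ : ∀ t, y₁ t = ∑ k ∈ range (N + 1), ((k : ℝ) / N) ^ 1 * p (k : ℤ) t)
    (hy₂ : ∀ t, y₂ t = ∑ k ∈ range (N + 1), ((k : ℝ) / N) ^ 2 * p (k : ℤ) t)
    (hy₃ : ∀ t, y₃ t = ∑ k ∈ range (N + 1), ((k : ℝ) / N) ^ 3 * p (k : ℤ) t) :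
    ∀ t : ℝ,
      HasDerivAt y₁ ((β - γ) * y₁ t - β * y₂ t) t ∧
      HasDerivAt y₂
        (2 * (β - γ) * y₂ t - 2 * β * y₃ t + (1 / N) * ((β + γ) * y₁ t - β * y₂ t)) t := by
  intro t
  have hN0 : (N : ℝ) ≠ 0 := by positivity
  have key := moment_aux N τ γ p a c ha hc hKE
  constructor
  · convert key (fun k => ((k : ℝ) / N) ^ 1) t using 1
    · funext s; rw [hy₁]; simp
    · rw [hy₁, hy₂, hβ]
      simp only [mul_sum, ← sum_sub_distrib]
      apply sum_congr rfl
      intro k _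
      push_cast
      field_simp
      ring
  · convert key (fun k => ((k : ℝ) / N) ^ 2) t using 1
    · funext s; rw [hy₂]; simp
    · rw [hy₁, hy₂, hy₃, hβ]
      simp only [mul_sum, ← sum_sub_distrib, ← sum_add_distrib]
      apply sum_congr rfl
      intro k _
      push_cast
      field_simp
      ring
end

section
/- Let N ∈ ℕ, N ≥ 1, and p ∈ (0,1], and let X ~ Binomial(N, p). Define the density-dependent moments y_j = E[X^j]/N^j for j = 1, 2, 3. Then y_3 = 2y_2²/y_1 − y_1 y_2 + (1/N)(y_1² − y_2), and moreover y_2 = y_1² + (y_1 − y_1²)/N. -/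
open Finset

lemma binom_step (n : ℕ) (p : ℝ) (f : ℕ → ℝ) :
    ∑ k ∈ range (n + 1 + 1), ((k : ℝ) * f k) * ((n+1).choose k : ℝ) * p ^ k * (1 - p) ^ (n + 1 - k)
    = ((n : ℝ) + 1) * p *
      ∑ k ∈ range (n + 1), f (k+1) * (n.choose k : ℝ) * p ^ k * (1 - p) ^ (n - k) := by
  rw [Finset.sum_range_succ', Finset.mul_sum]
  simp only [Nat.cast_zero, zero_mul, add_zero]
  refine Finset.sum_congr rfl fun k _ => ?_
  have h : ((n : ℝ) + 1) * (n.choose k : ℝ) = ((n+1).choose (k+1) : ℝ) * ((k : ℝ) + 1) := by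
    exact_mod_cast Nat.add_one_mul_choose_eq n k
  rw [Nat.add_sub_add_right, pow_succ]
  push_cast
  linear_combination (-(f (k+1) * p ^ k * p * (1 - p) ^ (n - k))) * h

lemma binom_m0 (n : ℕ) (p : ℝ) :
    ∑ k ∈ range (n + 1), (n.choose k : ℝ) * p ^ k * (1 - p) ^ (n - k) = 1 := by
  have h := add_pow p (1 - p) n
  rw [add_sub_cancel, one_pow] at h
  refine Eq.trans ?_ h.symm
  exact Finset.sum_congr rfl fun k _ => by ring

lemma binom_m1 (n : ℕ) (p : ℝ) :
    ∑ k ∈ range (n + 1), (k : ℝ) * (n.choose k : ℝ) * p ^ k * (1 - p) ^ (n - k) = n * p := by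
  cases n with
  | zero => simp
  | succ n =>
    have h := binom_step n p (fun _ => 1)
    simp only [mul_one, one_mul, binom_m0] at h
    rw [h]; push_cast; ring

lemma binom_m2 (n : ℕ) (p : ℝ) :
    ∑ k ∈ range (n + 1), (k : ℝ) ^ 2 * (n.choose k : ℝ) * p ^ k * (1 - p) ^ (n - k)
      = n * p * ((n - 1) * p + 1) := by
  cases n with
  | zero => simp
  | succ n =>
    have h := binom_step n p (fun k => (k : ℝ))
    simp only [Nat.cast_add, Nat.cast_one, add_mul, one_mul, Finset.sum_add_distrib, binom_m0,
      binom_m1] at h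
    simp only [pow_two]
    rw [h]; push_cast; ring

lemma binom_m3 (n : ℕ) (p : ℝ) :
    ∑ k ∈ range (n + 1), (k : ℝ) ^ 3 * (n.choose k : ℝ) * p ^ k * (1 - p) ^ (n - k)
      = n * p * ((n - 1) * (n - 2) * p ^ 2 + 3 * (n - 1) * p + 1) := by
  cases n with
  | zero => simp
  | succ n =>
    have h := binom_step n p (fun k => (k : ℝ) ^ 2)
    have e : ∀ k : ℕ, ((k + 1 : ℕ) : ℝ) ^ 2 = (k : ℝ) ^ 2 + (k : ℝ) + (k : ℝ) + 1 := by
      intro k; push_cast; ring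
    simp only [e, add_mul, one_mul, Finset.sum_add_distrib, binom_m0,
      binom_m1, binom_m2] at h
    simp only [pow_succ' _ 2]
    rw [h]; push_cast; ring

/-- For `X ~ Binomial(N, p)` with `N ≥ 1` and `p ∈ (0,1]`, the density-dependent
moments `y_j = E[X^j]/N^j` satisfy the binomial closure
`y₃ = 2y₂²/y₁ - y₁y₂ + (1/N)(y₁² - y₂)` and the pair-level relation
`y₂ = y₁² + (y₁ - y₁²)/N`. -/
theorem binomial_closure_density_moments
    (N : ℕ) (hN : 1 ≤ N) (p : ℝ) (hp0 : 0 < p) (hp1 : p ≤ 1)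
    (y : ℕ → ℝ)
    (hy : ∀ j, y j = (∑ k ∈ range (N + 1),
      (k : ℝ) ^ j * (N.choose k : ℝ) * p ^ k * (1 - p) ^ (N - k)) / (N : ℝ) ^ j) :
    y 3 = 2 * (y 2) ^ 2 / y 1 - y 1 * y 2 + (1 / N) * ((y 1) ^ 2 - y 2) ∧
    y 2 = (y 1) ^ 2 + (y 1 - (y 1) ^ 2) / N := by
  have hN' : (N : ℝ) ≠ 0 := by
    have : N ≠ 0 := by omega
    exact_mod_cast this
  have h1 : y 1 = p := by
    rw [hy 1]; simp only [pow_one]; rw [binom_m1]; field_simp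
  have h2 : y 2 = p * ((N - 1) * p + 1) / N := by
    rw [hy 2, binom_m2]; field_simp
  have h3 : y 3 = p * ((N - 1) * (N - 2) * p ^ 2 + 3 * (N - 1) * p + 1) / N ^ 2 := by
    rw [hy 3, binom_m3]; field_simp
  have hp := hp0.ne'
  rw [h1, h2, h3]
  constructor
  · field_simp; ring
  · field_simp; ring
end

section
/- Let N ≥ 3 and β > γ > 0 be real numbers with (N−2)β − Nγ > 0 and (N−1)(N−2)β − Nγ ≠ 0 and y_1* ≠ 1, where y_1* = (N−1)((N−2)β − Nγ)/((N−1)(N−2)β − Nγ) and y_2* = ((β − γ)/β) y_1*. Then the point (y_1*, y_2*) is an equilibrium of the moment system with the classic triple closure, i.e. (β − γ) y_1* − β y_2* = 0 and 2(β − γ) y_2* − 2β y_3* + (1/N)((β + γ) y_1* − β y_2*) = 0, where y_3* = −(1/N) y_1* + (1 + 1/N) y_2* − ((N − 2)/(N − 1)) (y_1* − y_2*)²/(1 − y_1*). -/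
/-- The point `(y₁*, y₂*)` with `y₁* = (N-1)((N-2)β - Nγ)/((N-1)(N-2)β - Nγ)` and
`y₂* = ((β-γ)/β) y₁*` is an equilibrium of the moment system closed with the
classic triple closure. -/
theorem triple_closure_steady_state
    (N : ℕ) (hN : 3 ≤ N) (β γ : ℝ) (hγ : 0 < γ) (hβγ : γ < β)
    (hpos : ((N : ℝ) - 2) * β - N * γ > 0)
    (hden : ((N : ℝ) - 1) * ((N : ℝ) - 2) * β - N * γ ≠ 0)
    (y₁ y₂ y₃ : ℝ)
    (hy₁ : y₁ = ((N : ℝ) - 1) * (((N : ℝ) - 2) * β - N * γ) /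
      (((N : ℝ) - 1) * ((N : ℝ) - 2) * β - N * γ))
    (hy₁1 : y₁ ≠ 1)
    (hy₂ : y₂ = (β - γ) / β * y₁)
    (hy₃ : y₃ = -(1 / N) * y₁ + (1 + 1 / N) * y₂ -
      ((N : ℝ) - 2) / ((N : ℝ) - 1) * ((y₁ - y₂) ^ 2 / (1 - y₁))) :
    (β - γ) * y₁ - β * y₂ = 0 ∧
    2 * (β - γ) * y₂ - 2 * β * y₃ + (1 / N) * ((β + γ) * y₁ - β * y₂) = 0 := by
  have hn : (3 : ℝ) ≤ N := by exact_mod_cast hN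
  have hN0 : (N : ℝ) ≠ 0 := by linarith
  have hN1 : (N : ℝ) - 1 ≠ 0 := by linarith
  have hN2 : (N : ℝ) - 2 ≠ 0 := by linarith
  have hβ : β ≠ 0 := by linarith
  have hγ0 : γ ≠ 0 := hγ.ne'
  have h1 : 1 - y₁ = N * (N - 2) * γ / (((N : ℝ) - 1) * ((N : ℝ) - 2) * β - N * γ) := by
    rw [hy₁, eq_div_iff hden, sub_mul, div_mul_cancel₀ _ hden]; ring
  have h2 : y₁ - y₂ = γ / β * y₁ := by
    rw [hy₂]; field_simp; ring
  have hyD : y₁ * (((N : ℝ) - 1) * ((N : ℝ) - 2) * β - N * γ)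
      = ((N : ℝ) - 1) * (((N : ℝ) - 2) * β - N * γ) := by
    rw [hy₁, div_mul_cancel₀ _ hden]
  have h3 : (y₁ - y₂) ^ 2 / (1 - y₁)
      = γ * y₁ * (((N : ℝ) - 1) * (((N : ℝ) - 2) * β - N * γ)) / (β ^ 2 * N * (N - 2)) := by
    rw [h1, h2, ← hyD]
    generalize ((N : ℝ) - 1) * ((N : ℝ) - 2) * β - N * γ = D at hden
    field_simp
  constructor
  · rw [hy₂]; field_simp; ring
  · rw [hy₃, h3, hy₂]
    clear hy₁ hy₂ hy₃ h1 h2 h3 hyD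
    field_simp
    ring
end

section
/- Let N ≥ 1 and β > γ > 0 be real numbers, set q = 1 − γ/β, and suppose Nq − 1 ≠ 0 and x_1* ≠ 0, where x_1* = (Nq² − 1)/(Nq − 1) and x_2* = q x_1*. Then the point (x_1*, x_2*) is an equilibrium of the moment system with the binomial closure, i.e. (β − γ) x_1* − β x_2* = 0 and 2(β − γ) x_2* − 2β x_3* + (1/N)((β + γ) x_1* − β x_2*) = 0, where x_3* = 2x_2*²/x_1* − x_1* x_2* + (1/N)(x_1*² − x_2*). -/
/-- The point `(x₁*, x₂*)` with `x₁* = (Nq² - 1)/(Nq - 1)`, `x₂* = q x₁*`, where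
`q = 1 - γ/β`, is an equilibrium of the moment system closed with the binomial
closure. -/
theorem binomial_closure_steady_state
    (N : ℕ) (hN : 1 ≤ N) (β γ : ℝ) (hγ : 0 < γ) (hβγ : γ < β)
    (q : ℝ) (hq : q = 1 - γ / β)
    (hden : (N : ℝ) * q - 1 ≠ 0)
    (x₁ x₂ x₃ : ℝ)
    (hx₁ : x₁ = ((N : ℝ) * q ^ 2 - 1) / ((N : ℝ) * q - 1))
    (hx₁0 : x₁ ≠ 0)
    (hx₂ : x₂ = q * x₁)
    (hx₃ : x₃ = 2 * x₂ ^ 2 / x₁ - x₁ * x₂ + (1 / N) * (x₁ ^ 2 - x₂)) :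
    (β - γ) * x₁ - β * x₂ = 0 ∧
    2 * (β - γ) * x₂ - 2 * β * x₃ + (1 / N) * ((β + γ) * x₁ - β * x₂) = 0 := by
  have hβ : β ≠ 0 := by linarith
  have hNr : (N : ℝ) ≠ 0 := by
    have : N ≠ 0 := by omega
    exact_mod_cast this
  have hg : γ = β * (1 - q) := by
    rw [hq]; field_simp; ring
  have hx : x₁ * ((N : ℝ) * q - 1) = (N : ℝ) * q ^ 2 - 1 := by
    rw [hx₁]; exact div_mul_cancel₀ _ hden
  have h3 : (N : ℝ) * x₃ = N * (2 * q ^ 2 * x₁ - q * x₁ ^ 2) + (x₁ ^ 2 - q * x₁) := by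
    rw [hx₃, hx₂]; field_simp
  clear hx₁ hx₃ hq
  subst hx₂ hg
  refine ⟨by ring, ?_⟩
  apply mul_left_cancel₀ hNr
  have e : (N : ℝ) * (1 / N) = 1 := by field_simp
  linear_combination (-2 * β) * h3 + 2 * β * x₁ * hx +
    ((β + β * (1 - q)) * x₁ - β * (q * x₁)) * e
end
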